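/- Let g, h be 3-Lie algebras over a field K of characteristic 0 and (ρ,ν,ω) extension data such that (g⊕h, [·,·,·]_{(ρ,ν,ω)}) is a 3-Lie algebra. Let p: ∧²(g⊕h) → ∧²g be the map induced by the projection g⊕h → g. Then p is a surjective Leibniz algebra morphism from (∧²(g⊕h), [·,·]_F̂) to (∧²g, [·,·]_F), its kernel is the image of the embedding ι: (∧²h)⊕(g⊗h) → ∧²(g⊕h) (ι(u∧v) = u∧v, ι(x⊗w) = x∧w), and the bracket [·,·]_F̂ restricted to this kernel corresponds under ι to the Leibniz bracket {·,·}; hence 0 → ((∧²h)⊕(g⊗h), {·,·}) → (∧²(g⊕h), [·,·]_F̂) → (∧²g, [·,·]_F) → 0 is a non-abelian extension of Leibniz algebras. -/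

import Mathlib

open scoped TensorProduct

section

variable {K : Type*} [Field K]
variable {g h : Type*} [AddCommGroup g] [Module K g] [AddCommGroup h] [Module K h]

/-- The bracket `[·,·,·]_{(ρ,ν,ω)}` on `g ⊕ h` built from extension data. -/
def extBracket (bg : g →ₗ[K] g →ₗ[K] g →ₗ[K] g) (bh : h →ₗ[K] h →ₗ[K] h →ₗ[K] h)
    (ρ : g →ₗ[K] g →ₗ[K] Module.End K h)
    (ν : g →ₗ[K] h →ₗ[K] h →ₗ[K] h)
    (ω : g →ₗ[K] g →ₗ[K] g →ₗ[K] h) :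
    g × h → g × h → g × h → g × h :=
  fun a b c =>
    (bg a.1 b.1 c.1,
      ω a.1 b.1 c.1 + ρ a.1 b.1 c.2 + ρ b.1 c.1 a.2 + ρ c.1 a.1 b.2
        + ν a.1 b.2 c.2 + ν b.1 c.2 a.2 + ν c.1 a.2 b.2 + bh a.2 b.2 c.2)

end

/-- The simple wedge `x ∧ y` in the second exterior power `⋀[K]^2 g`. -/
noncomputable def wedge2 (K : Type*) [Field K] {g : Type*} [AddCommGroup g] [Module K g]
    (x y : g) : ⋀[K]^2 g :=
  ⟨ExteriorAlgebra.ιMulti K 2 ![x, y], ExteriorAlgebra.ιMulti_range K 2 (Set.mem_range_self _)⟩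

theorem update_pair_zero {α : Type*} (x y z : α) : Function.update ![x, y] 0 z = ![z, y] := by
  ext i
  fin_cases i <;> rfl

theorem update_pair_one {α : Type*} (x y z : α) : Function.update ![x, y] 1 z = ![x, z] := by
  ext i
  fin_cases i <;> rfl

section Wedge

variable {K : Type*} [Field K] {V W : Type*} [AddCommGroup V] [Module K V]
  [AddCommGroup W] [Module K W]

theorem wedge2_eq_ιMulti (x y : V) : wedge2 K x y = exteriorPower.ιMulti K 2 ![x, y] := rfl

theorem wedge2_add_left (x x' y : V) :
    wedge2 K (x + x') y = wedge2 K x y + wedge2 K x' y := by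
  simpa only [wedge2_eq_ιMulti, update_pair_zero, update_pair_one] using
    (exteriorPower.ιMulti K 2).map_update_add ![x, y] 0 x x'

theorem wedge2_add_right (x y y' : V) :
    wedge2 K x (y + y') = wedge2 K x y + wedge2 K x y' := by
  simpa only [wedge2_eq_ιMulti, update_pair_zero, update_pair_one] using
    (exteriorPower.ιMulti K 2).map_update_add ![x, y] 1 y y'

theorem wedge2_smul_left (c : K) (x y : V) : wedge2 K (c • x) y = c • wedge2 K x y := by
  simpa only [wedge2_eq_ιMulti, update_pair_zero, update_pair_one] using
    (exteriorPower.ιMulti K 2).map_update_smul ![x, y] 0 c x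

@[simp]
theorem wedge2_zero_left (y : V) : wedge2 K 0 y = 0 := by
  simpa using wedge2_smul_left (0 : K) 0 y

@[simp]
theorem wedge2_zero_right (x : V) : wedge2 K x 0 = 0 := by
  simpa using wedge2_add_right (K := K) x 0 0

theorem wedge2_neg_left (x y : V) : wedge2 K (-x) y = -wedge2 K x y := by
  refine eq_neg_of_add_eq_zero_left ?_
  rw [← wedge2_add_left, neg_add_cancel, wedge2_zero_left]

theorem wedge2_swap (x y : V) : wedge2 K x y = -wedge2 K y x := by
  have self_zero (z : V) : wedge2 K z z = 0 :=
    (exteriorPower.ιMulti K 2).map_eq_zero_of_eq ![z, z] (i := 0) (j := 1) rfl (by decide)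
  have key := self_zero (x + y)
  rw [wedge2_add_left, wedge2_add_right, wedge2_add_right, self_zero, self_zero,
    zero_add, add_zero] at key
  exact eq_neg_of_add_eq_zero_left key

theorem map_wedge2 (f : V →ₗ[K] W) (x y : V) :
    exteriorPower.map 2 f (wedge2 K x y) = wedge2 K (f x) (f y) := by
  rw [wedge2_eq_ιMulti, exteriorPower.map_apply_ιMulti, wedge2_eq_ιMulti]
  congr 1
  ext i
  fin_cases i <;> rfl

theorem wedge2_induction {p : ⋀[K]^2 V → Prop} (wedge : ∀ x y, p (wedge2 K x y))
    (add : ∀ X Y, p X → p Y → p (X + Y)) (X : ⋀[K]^2 V) : p X := by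
  have hX : X ∈ Submodule.span K (Set.range (exteriorPower.ιMulti K 2 (M := V))) := by
    rw [exteriorPower.ιMulti_span]
    trivial
  induction hX using Submodule.closure_induction with
  | zero => simpa using wedge 0 0
  | add X Y _ _ hX hY => exact add X Y hX hY
  | smul_mem c X hX =>
    obtain ⟨v, rfl⟩ := hX
    convert wedge (c • v 0) (v 1) using 1
    rw [wedge2_smul_left, wedge2_eq_ιMulti]
    congr 2
    ext i
    fin_cases i <;> rfl

theorem wedge2_prod_tensor_induction {p : ⋀[K]^2 W × (V ⊗[K] W) → Prop}
    (wedge : ∀ u v, p (wedge2 K u v, 0)) (tmul : ∀ x w, p (0, x ⊗ₜ[K] w))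
    (add : ∀ a b, p a → p b → p (a + b)) (a : ⋀[K]^2 W × (V ⊗[K] W)) : p a := by
  obtain ⟨A, T⟩ := a
  have hA : p (A, 0) := by
    induction A using wedge2_induction with
    | wedge x y => exact wedge x y
    | add X Y hX hY => simpa using add _ _ hX hY
  have hT : p (0, T) := by
    induction T using TensorProduct.induction_on with
    | zero => simpa using tmul 0 0
    | tmul x w => exact tmul x w
    | add X Y hX hY => simpa using add _ _ hX hY
  simpa using add _ _ hA hT

end Wedge

/-- the map `p : ⋀²(g⊕h) → ⋀²g` induced by the projection is a surjective
Leibniz algebra morphism whose kernel is the image of `ι : (⋀²h) ⊕ (g⊗h) → ⋀²(g⊕h)`,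
on which the fundamental bracket corresponds to `{·,·}`; i.e. we get a non-abelian
extension of Leibniz algebras. -/
theorem fundamental_extension_of_leibniz {K : Type*} [Field K] [CharZero K]
    {g h : Type*} [AddCommGroup g] [Module K g] [AddCommGroup h] [Module K h]
    (bg : g →ₗ[K] g →ₗ[K] g →ₗ[K] g) (bh : h →ₗ[K] h →ₗ[K] h →ₗ[K] h)
    (hgalt : ∀ x y z : g, x = y ∨ y = z ∨ x = z → bg x y z = 0)
    (hgfi : ∀ x1 x2 x3 x4 x5 : g,
      bg x1 x2 (bg x3 x4 x5)
        = bg (bg x1 x2 x3) x4 x5 + bg x3 (bg x1 x2 x4) x5 + bg x3 x4 (bg x1 x2 x5))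
    (hhalt : ∀ u v w : h, u = v ∨ v = w ∨ u = w → bh u v w = 0)
    (hhfi : ∀ v1 v2 v3 v4 v5 : h,
      bh v1 v2 (bh v3 v4 v5)
        = bh (bh v1 v2 v3) v4 v5 + bh v3 (bh v1 v2 v4) v5 + bh v3 v4 (bh v1 v2 v5))
    (ρ : g →ₗ[K] g →ₗ[K] Module.End K h) (hρ : ∀ x y : g, ρ x y = - ρ y x)
    (ν : g →ₗ[K] h →ₗ[K] h →ₗ[K] h) (hν : ∀ (x : g) (u v : h), ν x u v = - ν x v u)
    (ω : g →ₗ[K] g →ₗ[K] g →ₗ[K] h)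
    (hω : ∀ x y z : g, x = y ∨ y = z ∨ x = z → ω x y z = 0)
    (healt : ∀ a b c : g × h, a = b ∨ b = c ∨ a = c → extBracket bg bh ρ ν ω a b c = 0)
    (hefi : ∀ a1 a2 a3 a4 a5 : g × h,
      extBracket bg bh ρ ν ω a1 a2 (extBracket bg bh ρ ν ω a3 a4 a5)
        = extBracket bg bh ρ ν ω (extBracket bg bh ρ ν ω a1 a2 a3) a4 a5
          + extBracket bg bh ρ ν ω a3 (extBracket bg bh ρ ν ω a1 a2 a4) a5
          + extBracket bg bh ρ ν ω a3 a4 (extBracket bg bh ρ ν ω a1 a2 a5))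
    -- the fundamental bracket [·,·]_F̂ on ⋀²(g⊕h):
    (F : ⋀[K]^2 (g × h) →ₗ[K] ⋀[K]^2 (g × h) →ₗ[K] ⋀[K]^2 (g × h))
    (hF : ∀ e1 e2 f1 f2 : g × h,
      F (wedge2 K e1 e2) (wedge2 K f1 f2)
        = wedge2 K (extBracket bg bh ρ ν ω e1 e2 f1) f2
          + wedge2 K f1 (extBracket bg bh ρ ν ω e1 e2 f2))
    -- the fundamental bracket [·,·]_F on ⋀²g:
    (Fg : ⋀[K]^2 g →ₗ[K] ⋀[K]^2 g →ₗ[K] ⋀[K]^2 g)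
    (hFg : ∀ x1 x2 y1 y2 : g,
      Fg (wedge2 K x1 x2) (wedge2 K y1 y2)
        = wedge2 K (bg x1 x2 y1) y2 + wedge2 K y1 (bg x1 x2 y2))
    -- the bracket {·,·} on (⋀²h) ⊕ (g ⊗ h):
    (B : (⋀[K]^2 h × (g ⊗[K] h)) →ₗ[K] (⋀[K]^2 h × (g ⊗[K] h)) →ₗ[K]
          (⋀[K]^2 h × (g ⊗[K] h)))
    (hB : ∀ (u1 v1 u2 v2 w1 w2 : h) (x1 x2 : g),
      B (wedge2 K u1 v1, x1 ⊗ₜ[K] w1) (wedge2 K u2 v2, x2 ⊗ₜ[K] w2)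
        = (wedge2 K (bh u1 v1 u2) v2 + wedge2 K u2 (bh u1 v1 v2)
            + wedge2 K (ν x2 u1 v1) w2 + wedge2 K (ν x1 w1 u2) v2
            + wedge2 K u2 (ν x1 w1 v2) - wedge2 K (ρ x1 x2 w1) w2,
           x2 ⊗ₜ[K] (bh u1 v1 w2) + x2 ⊗ₜ[K] (ν x1 w1 w2)))
    -- the canonical embedding ι:
    (ι : (⋀[K]^2 h × (g ⊗[K] h)) →ₗ[K] ⋀[K]^2 (g × h))
    (hι1 : ∀ u v : h, ι (wedge2 K u v, 0) = wedge2 K ((0 : g), u) ((0 : g), v))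
    (hι2 : ∀ (x : g) (w : h),
      ι (0, x ⊗ₜ[K] w) = wedge2 K (x, (0 : h)) ((0 : g), w))
    -- the map induced by the projection g ⊕ h → g:
    (P : ⋀[K]^2 (g × h) →ₗ[K] ⋀[K]^2 g)
    (hP : ∀ e1 e2 : g × h, P (wedge2 K e1 e2) = wedge2 K e1.1 e2.1) :
    Function.Surjective P ∧
    (∀ X Y : ⋀[K]^2 (g × h), P (F X Y) = Fg (P X) (P Y)) ∧
    LinearMap.ker P = LinearMap.range ι ∧
    (∀ a b : ⋀[K]^2 h × (g ⊗[K] h), F (ι a) (ι b) = ι (B a b)) := by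
  have hPmap (Z : ⋀[K]^2 g) : P (exteriorPower.map 2 (LinearMap.inl K g h) Z) = Z := by
    induction Z using wedge2_induction with
    | wedge x y => simp [map_wedge2, hP]
    | add X Y hX hY => simp [hX, hY]
  refine ⟨fun Z => ⟨_, hPmap Z⟩, fun X Y => ?_, le_antisymm ?_ ?_, fun a b => ?_⟩
  · induction X using wedge2_induction with
    | add X X' hX hX' => simp [hX, hX']
    | wedge e₁ e₂ =>
      induction Y using wedge2_induction with
      | add Y Y' hY hY' => simp only [map_add, hY, hY']
      | wedge f₁ f₂ => simp [hF, hFg, hP, extBracket]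
  · have hdecomp (X : ⋀[K]^2 (g × h)) :
        X - exteriorPower.map 2 (LinearMap.inl K g h) (P X) ∈ LinearMap.range ι := by
      induction X using wedge2_induction with
      | add X Y hX hY =>
        convert add_mem hX hY using 1
        simp only [map_add]
        abel
      | wedge e₁ e₂ =>
        obtain ⟨x, u⟩ := e₁
        obtain ⟨y, v⟩ := e₂
        refine ⟨(wedge2 K u v, 0) + (0, x ⊗ₜ[K] v) - (0, y ⊗ₜ[K] u), ?_⟩
        have hx : ((x, u) : g × h) = (x, 0) + (0, u) := by simp
        have hy : ((y, v) : g × h) = (y, 0) + (0, v) := by simp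
        rw [map_sub, map_add, hι1, hι2, hι2, hP, map_wedge2, hx, hy]
        simp only [wedge2_add_left, wedge2_add_right]
        simp only [Prod.mk_add_mk, add_zero, zero_add, LinearMap.inl_apply]
        rw [wedge2_swap ((y, 0) : g × h)]
        abel
    intro X hX
    simpa [LinearMap.mem_ker.mp hX] using hdecomp X
  · rintro _ ⟨a, rfl⟩
    rw [LinearMap.mem_ker]
    induction a using wedge2_prod_tensor_induction with
    | wedge u v => simp [hι1, hP]
    | tmul x w => simp [hι2, hP]
    | add a b ha hb => simp only [map_add, ha, hb, add_zero]
  · have hι (A : ⋀[K]^2 h) (T : g ⊗[K] h) : ι (A, T) = ι (A, 0) + ι (0, T) := by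
      simp [← map_add]
    induction a using wedge2_prod_tensor_induction with
    | add a a' ha ha' => simp only [map_add, LinearMap.add_apply, ha, ha']
    | wedge u₁ v₁ =>
      induction b using wedge2_prod_tensor_induction with
      | add b b' hb hb' => simp only [map_add, hb, hb']
      | wedge u₂ v₂ =>
        have hB' := hB u₁ v₁ u₂ v₂ 0 0 0 0
        simp only [TensorProduct.zero_tmul, map_zero, LinearMap.zero_apply, wedge2_zero_left,
          wedge2_zero_right, add_zero, sub_zero] at hB'
        rw [hB', hι1, hι1, hF, ← add_zero (0 : g ⊗[K] h), ← Prod.mk_add_mk, map_add, hι1, hι1]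
        simp [extBracket]
      | tmul x₂ w₂ =>
        have hB' := hB u₁ v₁ 0 0 0 w₂ 0 x₂
        simp only [TensorProduct.tmul_zero, map_zero, LinearMap.zero_apply, wedge2_zero_left,
          wedge2_zero_right, add_zero, zero_add, sub_zero] at hB'
        rw [hι1, hι2, hF, hB', hι, hι1, hι2]
        simp [extBracket]
    | tmul x₁ w₁ =>
      induction b using wedge2_prod_tensor_induction with
      | add b b' hb hb' => simp only [map_add, hb, hb']
      | wedge u₂ v₂ =>
        have hB' := hB 0 0 u₂ v₂ w₁ 0 x₁ 0
        simp only [TensorProduct.tmul_zero, map_zero, LinearMap.zero_apply, wedge2_zero_left,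
          wedge2_zero_right, add_zero, zero_add, sub_zero] at hB'
        rw [hB', hι2, hι1, hF, ← add_zero (0 : g ⊗[K] h), ← Prod.mk_add_mk, map_add, hι1, hι1]
        simp [extBracket]
      | tmul x₂ w₂ =>
        have hB' := hB 0 0 0 0 w₁ w₂ x₁ x₂
        simp only [TensorProduct.tmul_zero, map_zero, LinearMap.zero_apply, wedge2_zero_left,
          wedge2_zero_right, add_zero, zero_add, zero_sub] at hB'
        rw [hB', hι2, hι2, hF, ← wedge2_neg_left, hι, hι1, hι2]
        simp [extBracket, hρ x₂ x₁]
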